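/- arXiv:1809.02334 — 2 statements merged into one kernel-verified Lean document; each statement's English description precedes it below -/
import Mathlib

section
/- Let U be an r × N complex matrix with orthonormal rows, i.e. U Uᴴ = I_r, and let r ≤ n ≤ N. Let S be a set of n column indices such that the r × n submatrix Û = U_{:,S} has nonzero volume (det(Û Ûᴴ) ≠ 0) and has locally maximal volume with respect to single-column exchanges: for every j ∈ S and every i ∉ S, det(U_{:,(S\{j})∪{i}} (U_{:,(S\{j})∪{i}})ᴴ) ≤ det(Û Ûᴴ). Then for every vector x ∈ ℂ^r, ‖x Û‖₂² ≥ ‖x‖₂² / (1 + r(N−n)/(n−r+1)); equivalently, the spectral norm of the Moore–Penrose pseudoinverse satisfies ‖Û⁺‖₂ ≤ √(1 + r(N−n)/(n−r+1)). -/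
open Matrix BigOperators

/-- The submatrix of `U` consisting of the columns indexed by the finite set `S`. -/
def colsSub {r N : ℕ} (U : Matrix (Fin r) (Fin N) ℂ) (S : Finset (Fin N)) :
    Matrix (Fin r) {x // x ∈ S} ℂ :=
  U.submatrix id (fun x : {x // x ∈ S} => (x : Fin N))

/-- The squared volume `det(B Bᴴ)` (a nonnegative real) of the column submatrix `U_{:,S}`. -/
noncomputable def sqVol {r N : ℕ} (U : Matrix (Fin r) (Fin N) ℂ) (S : Finset (Fin N)) : ℝ :=
  ((colsSub U S * (colsSub U S)ᴴ).det).re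

open scoped ComplexOrder in
theorem sqVol_nonneg_and_im {r N : ℕ} (U : Matrix (Fin r) (Fin N) ℂ) (S : Finset (Fin N)) :
    0 ≤ sqVol U S ∧ (colsSub U S * (colsSub U S)ᴴ).det.im = 0 := by
  have h := (posSemidef_self_mul_conjTranspose (colsSub U S)).det_nonneg
  rw [Complex.le_def] at h
  exact ⟨h.1, h.2.symm⟩

theorem colsSub_mul_conjTranspose {r N : ℕ} (U : Matrix (Fin r) (Fin N) ℂ)
    (S : Finset (Fin N)) :
    colsSub U S * (colsSub U S)ᴴ = ∑ j ∈ S, vecMulVec (U.col j) (star (U.col j)) := by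
  ext k l
  rw [Matrix.sum_apply, ← Finset.sum_coe_sort]
  simp [Matrix.mul_apply, colsSub, vecMulVec_apply]

/-- Determinant of a matrix after adding one rank-one term and subtracting another. -/
theorem det_add_vecMulVec_sub_vecMulVec {ι R : Type*} [Fintype ι] [DecidableEq ι] [CommRing R]
    (A : Matrix ι ι R) (hA : IsUnit A.det) (u v w z : ι → R) :
    (A + vecMulVec u v - vecMulVec w z).det =
      A.det * ((1 + v ⬝ᵥ A⁻¹ *ᵥ u) * (1 - z ⬝ᵥ A⁻¹ *ᵥ w) +
        (v ⬝ᵥ A⁻¹ *ᵥ w) * (z ⬝ᵥ A⁻¹ *ᵥ u)) := by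
  have h : A + vecMulVec u v - vecMulVec w z =
      A + (of ![u, -w])ᵀ * of ![v, z] := by
    ext k l
    simp [Matrix.mul_apply, vecMulVec_apply, Fin.sum_univ_two]
    ring
  rw [h, det_add_mul _ _ hA, det_fin_two]
  have e : ∀ a b, (of ![v, z] * A⁻¹ * (of ![u, -w])ᵀ) a b =
      ![v, z] a ⬝ᵥ A⁻¹ *ᵥ ![u, -w] b := by
    intro a b
    rw [Matrix.mul_assoc]
    rfl
  simp only [Matrix.add_apply, e]
  simp [mulVec_neg]
  ring

theorem sum_sq_norm_vecMul {ι κ : Type*} [Fintype ι] [Fintype κ] [DecidableEq ι]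
    (U : Matrix ι κ ℂ) (hU : U * Uᴴ = 1) (x : ι → ℂ) :
    ∑ j, ‖(x ᵥ* U) j‖ ^ 2 = ∑ k, ‖x k‖ ^ 2 := by
  have sq : ∀ z : ℂ, ((‖z‖ ^ 2 : ℝ) : ℂ) = z * star z := fun z => by
    simp [Complex.mul_conj']
  have h : (x ᵥ* U) ⬝ᵥ star (x ᵥ* U) = x ⬝ᵥ star x := by
    rw [star_vecMul, dotProduct_mulVec, vecMul_vecMul, hU, vecMul_one]
  apply Complex.ofReal_injective
  rw [Complex.ofReal_sum, Complex.ofReal_sum]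
  simpa only [sq, dotProduct, Pi.star_apply] using h

/-- The Cauchy-Schwarz inequality for finite sums of complex numbers. -/
theorem norm_sum_mul_sq_le {κ : Type*} (S : Finset κ) (a b : κ → ℂ) :
    ‖∑ j ∈ S, a j * b j‖ ^ 2 ≤ (∑ j ∈ S, ‖a j‖ ^ 2) * ∑ j ∈ S, ‖b j‖ ^ 2 := by
  calc ‖∑ j ∈ S, a j * b j‖ ^ 2 ≤ (∑ j ∈ S, ‖a j‖ * ‖b j‖) ^ 2 := by
        gcongr
        exact (norm_sum_le _ _).trans_eq (by simp)
    _ ≤ _ := Finset.sum_mul_sq_le_sq_mul_sq _ _ _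

/-- Replacing column `j` by column `i`, the squared volume is multiplied by
`(1 + C i i) * (1 - C j j) + C i j * C j i`, where `C = Uᴴ * A⁻¹ * U`. -/
theorem det_exchange {r N : ℕ} (U : Matrix (Fin r) (Fin N) ℂ) (S : Finset (Fin N))
    {A : Matrix (Fin r) (Fin r) ℂ} (hA : A = colsSub U S * (colsSub U S)ᴴ)
    (hdet : IsUnit A.det) {C : Matrix (Fin N) (Fin N) ℂ} (hC : C = Uᴴ * A⁻¹ * U)
    {i j : Fin N} (hj : j ∈ S) (hi : i ∉ S) :
    (colsSub U (insert i (S.erase j)) * (colsSub U (insert i (S.erase j)))ᴴ).det =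
      A.det * ((1 + C i i) * (1 - C j j) + C i j * C j i) := by
  have e : colsSub U (insert i (S.erase j)) * (colsSub U (insert i (S.erase j)))ᴴ =
      A + vecMulVec (U.col i) (star (U.col i)) - vecMulVec (U.col j) (star (U.col j)) := by
    rw [hA, colsSub_mul_conjTranspose, colsSub_mul_conjTranspose,
      Finset.sum_insert (fun h => hi (Finset.mem_of_mem_erase h)), ← Finset.add_sum_erase _ _ hj]
    abel
  have hC' : ∀ k l, C k l = star (U.col k) ⬝ᵥ A⁻¹ *ᵥ U.col l := fun k l => by
    rw [hC, Matrix.mul_assoc]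
    rfl
  rw [e, det_add_vecMulVec_sub_vecMulVec A hdet]
  simp only [hC']

/-- If `colsSub U S` has locally maximal volume, every column of `U` outside `S` is a combination
of the columns in `S` whose coefficient vector has squared norm at most `r / (n - r + 1)`. -/
theorem exists_coeff_of_locally_max {r n N : ℕ} (hrn : r ≤ n)
    (U : Matrix (Fin r) (Fin N) ℂ) (S : Finset (Fin N)) (hS : S.card = n)
    (hvol : sqVol U S ≠ 0)
    (hloc : ∀ j ∈ S, ∀ i ∉ S, sqVol U (insert i (S.erase j)) ≤ sqVol U S) :
    ∃ D : Matrix {x // x ∈ S} (Fin N) ℂ, colsSub U S * D = U ∧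
      ∀ i ∉ S, ∑ j, ‖D j i‖ ^ 2 ≤ (r : ℝ) / ((n : ℝ) - r + 1) := by
  set B := colsSub U S with hB
  set A := B * Bᴴ with hA
  obtain ⟨hpos, him⟩ := sqVol_nonneg_and_im U S
  have hvol' : sqVol U S = A.det.re := rfl
  have hpos' : 0 < A.det.re := lt_of_le_of_ne hpos hvol.symm
  have hdet : IsUnit A.det := by
    rw [isUnit_iff_ne_zero]
    intro h
    simp [h] at hpos'
  have hAinv : (A⁻¹)ᴴ = A⁻¹ := by
    rw [conjTranspose_nonsing_inv, hA, conjTranspose_mul, conjTranspose_conjTranspose]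
  set D := Bᴴ * A⁻¹ * U with hD
  set C := Uᴴ * A⁻¹ * U with hC
  have hDC : ∀ j i, D j i = C j i := fun j i => rfl
  have hBD : B * D = U := by
    rw [hD, ← Matrix.mul_assoc, ← Matrix.mul_assoc, ← hA, mul_nonsing_inv _ hdet, Matrix.one_mul]
  have hDD : Dᴴ * D = C := by
    rw [hD, conjTranspose_mul, conjTranspose_mul, conjTranspose_conjTranspose, hAinv,
      Matrix.mul_assoc, Matrix.mul_assoc, ← hD, hBD, hC, Matrix.mul_assoc]
  have hCH : ∀ i j, C i j = star (C j i) := fun i j => by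
    rw [← conjTranspose_apply]
    rw [hC, conjTranspose_mul, conjTranspose_mul, conjTranspose_conjTranspose, hAinv,
      Matrix.mul_assoc]
  have hCii : ∀ i, C i i = ((∑ j, ‖D j i‖ ^ 2 : ℝ) : ℂ) := fun i => by
    rw [← hDD]
    simp [Matrix.mul_apply, Complex.conj_mul']
  have htr : ∑ j : {x // x ∈ S}, C j j = r := by
    have h : (Bᴴ * A⁻¹ * B).trace = r := by
      rw [Matrix.mul_assoc, trace_mul_comm, Matrix.mul_assoc, ← hA, nonsing_inv_mul _ hdet]
      simp
    exact h
  have htr' : ∑ j : {x // x ∈ S}, (C j j).re = r := by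
    simpa using congrArg Complex.re htr
  refine ⟨D, hBD, fun i hi => ?_⟩
  set a := ∑ j, ‖D j i‖ ^ 2 with ha
  have hex : ∀ j : {x // x ∈ S}, (1 + a) * (1 - (C j j).re) + ‖D j i‖ ^ 2 ≤ 1 := fun j => by
    have h := hloc j j.2 i hi
    rw [hvol', sqVol, det_exchange U S hA hdet hC j.2 hi, Complex.mul_re, him, zero_mul,
      sub_zero] at h
    have h1 := le_of_mul_le_mul_left (h.trans_eq (mul_one _).symm) hpos'
    have h2 : C i j * C j i = ((‖D j i‖ ^ 2 : ℝ) : ℂ) := by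
      rw [hCH i j, hDC]
      simp [Complex.conj_mul']
    rw [h2, hCii i, ← ha] at h1
    simpa [← Complex.ofReal_pow] using h1
  have hsum := Finset.sum_le_sum fun j (_ : j ∈ Finset.univ) => hex j
  rw [Finset.sum_add_distrib, ← Finset.mul_sum, Finset.sum_sub_distrib, htr', ← ha] at hsum
  simp only [Finset.sum_const, Finset.card_univ, Fintype.card_coe, hS, nsmul_eq_mul,
    mul_one] at hsum
  have hrn' : (r : ℝ) ≤ n := by exact_mod_cast hrn
  rw [le_div_iff₀ (by linarith)]
  linarith

/-- If `U` has orthonormal rows and `Û = U_{:,S}` is an `r × n` column submatrix of nonzero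
volume with locally maximal volume under single-column exchanges, then for every `x ∈ ℂ^r`,
`‖x Û‖₂² ≥ ‖x‖₂² / (1 + r(N−n)/(n−r+1))`, i.e. `‖Û⁺‖₂ ≤ √(1 + r(N−n)/(n−r+1))`. -/
theorem statement11 (r n N : ℕ) (hrn : r ≤ n) (hnN : n ≤ N)
    (U : Matrix (Fin r) (Fin N) ℂ) (hU : U * Uᴴ = 1)
    (S : Finset (Fin N)) (hS : S.card = n)
    (hvol : sqVol U S ≠ 0)
    (hloc : ∀ j ∈ S, ∀ i ∉ S, sqVol U (insert i (S.erase j)) ≤ sqVol U S) :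
    ∀ x : Fin r → ℂ,
      (∑ k, ‖x k‖ ^ 2) / (1 + (r : ℝ) * ((N : ℝ) - (n : ℝ)) / ((n : ℝ) - (r : ℝ) + 1))
        ≤ ∑ j, ‖(x ᵥ* colsSub U S) j‖ ^ 2 := by
  intro x
  obtain ⟨D, hBD, hD⟩ := exists_coeff_of_locally_max hrn U S hS hvol hloc
  set y := x ᵥ* colsSub U S with hy
  have hrn' : (r : ℝ) ≤ n := by exact_mod_cast hrn
  have hnN' : (n : ℝ) ≤ N := by exact_mod_cast hnN
  have hfrac : 0 ≤ (r : ℝ) * ((N : ℝ) - n) / ((n : ℝ) - r + 1) :=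
    div_nonneg (mul_nonneg r.cast_nonneg (by linarith)) (by linarith)
  have hout : ∀ i ∈ Sᶜ, ‖(x ᵥ* U) i‖ ^ 2 ≤ (∑ j, ‖y j‖ ^ 2) * (r / ((n : ℝ) - r + 1)) := by
    intro i hi
    have h : (x ᵥ* U) i = ∑ j, y j * D j i := by
      rw [← hBD, ← vecMul_vecMul]
      rfl
    rw [h]
    exact (norm_sum_mul_sq_le _ _ _).trans
      (mul_le_mul_of_nonneg_left (hD i (Finset.mem_compl.mp hi)) (by positivity))
  have hin : ∑ j ∈ S, ‖(x ᵥ* U) j‖ ^ 2 = ∑ j, ‖y j‖ ^ 2 := by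
    rw [← Finset.sum_coe_sort]
    rfl
  have hcard : ((Sᶜ).card : ℝ) = N - n := by
    rw [Finset.card_compl, hS, Fintype.card_fin, Nat.cast_sub hnN]
  have hsum := Finset.sum_le_sum hout
  rw [Finset.sum_const, nsmul_eq_mul, hcard] at hsum
  rw [div_le_iff₀ (by linarith), ← sum_sq_norm_vecMul U hU x, ← Finset.sum_add_sum_compl S, hin]
  refine (add_le_add_right hsum _).trans_eq ?_
  ring
end

section
/- Let U be an r × N complex matrix with orthonormal rows, i.e. U Uᴴ = I_r, and let r ≤ n ≤ N. Let S be a set of n column indices such that the r × n submatrix Û = U_{:,S} has nonzero volume (det(Û Ûᴴ) ≠ 0) and has locally maximal volume with respect to single-column exchanges: for every j ∈ S and every i ∉ S, det(U_{:,(S\{j})∪{i}} (U_{:,(S\{j})∪{i}})ᴴ) ≤ det(Û Ûᴴ). Then the matrix Û Ûᴴ is invertible and trace((Û Ûᴴ)^{-1}) ≤ r + r(N−n)/(n−r+1); equivalently, the Frobenius norm of the Moore–Penrose pseudoinverse satisfies ‖Û⁺‖_F ≤ √(r + r(N−n)/(n−r+1)). -/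
open Matrix BigOperators

lemma colsSub_mul_conjTranspose_apply {r N : ℕ} (U : Matrix (Fin r) (Fin N) ℂ)
    (S : Finset (Fin N)) (a b : Fin r) :
    (colsSub U S * (colsSub U S)ᴴ) a b = ∑ k ∈ S, U a k * star (U b k) := by
  simp only [colsSub, mul_apply, conjTranspose_apply, submatrix_apply, id_eq]
  exact Finset.sum_coe_sort S (fun k => U a k * star (U b k))

lemma colsSub_mul_conjTranspose_s12 {r N : ℕ} (U : Matrix (Fin r) (Fin N) ℂ) (S : Finset (Fin N)) :
    colsSub U S * (colsSub U S)ᴴ = U * diagonal (fun k => if k ∈ S then (1 : ℂ) else 0) * Uᴴ := by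
  ext a b
  rw [colsSub_mul_conjTranspose_apply, mul_apply]
  simp [mul_diagonal]

/-- Removing column `j` and adding column `i` is a rank-two update of the Gram matrix. -/
lemma colsSub_exchange {r N : ℕ} (U : Matrix (Fin r) (Fin N) ℂ) (S : Finset (Fin N))
    {i j : Fin N} (hj : j ∈ S) (hi : i ∉ S) :
    colsSub U (insert i (S.erase j)) * (colsSub U (insert i (S.erase j)))ᴴ =
      colsSub U S * (colsSub U S)ᴴ +
        U.submatrix id (![i, j] : Fin 2 → Fin N) *
          (diagonal (![1, -1] : Fin 2 → ℂ) * Uᴴ.submatrix (![i, j] : Fin 2 → Fin N) id) := by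
  ext a b
  rw [Matrix.add_apply, colsSub_mul_conjTranspose_apply, colsSub_mul_conjTranspose_apply,
    Finset.sum_insert (by simp [hi]), ← Finset.add_sum_erase S _ hj]
  rw [mul_apply, Fin.sum_univ_two, diagonal_mul, diagonal_mul]
  simp
  ring

/-- The determinant of the Gram matrix after a column exchange. -/
lemma det_colsSub_exchange {r N : ℕ} (U : Matrix (Fin r) (Fin N) ℂ) (S : Finset (Fin N))
    (hA : IsUnit (colsSub U S * (colsSub U S)ᴴ).det) {i j : Fin N} (hj : j ∈ S) (hi : i ∉ S)
    {P : Matrix (Fin N) (Fin N) ℂ}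
    (hP : P = Uᴴ * (colsSub U S * (colsSub U S)ᴴ)⁻¹ * U) :
    (colsSub U (insert i (S.erase j)) * (colsSub U (insert i (S.erase j)))ᴴ).det =
      (colsSub U S * (colsSub U S)ᴴ).det * ((1 + P i i) * (1 - P j j) + P i j * P j i) := by
  rw [colsSub_exchange U S hj hi, det_add_mul _ _ hA]
  congr 1
  have hsub : diagonal (![1, -1] : Fin 2 → ℂ) * Uᴴ.submatrix (![i, j] : Fin 2 → Fin N) id *
      (colsSub U S * (colsSub U S)ᴴ)⁻¹ * U.submatrix id (![i, j] : Fin 2 → Fin N) =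
        diagonal (![1, -1] : Fin 2 → ℂ) *
          P.submatrix (![i, j] : Fin 2 → Fin N) (![i, j] : Fin 2 → Fin N) := by
    rw [hP, submatrix_mul _ _ _ id _ Function.bijective_id,
      submatrix_mul _ _ _ id _ Function.bijective_id, submatrix_id_id]
    simp only [Matrix.mul_assoc]
  rw [hsub, det_fin_two]
  simp only [Matrix.add_apply, diagonal_mul, submatrix_apply, cons_val_zero, cons_val_one,
    one_apply_eq, one_apply_ne zero_ne_one, one_apply_ne one_ne_zero]
  ring

open scoped ComplexOrder in
lemma det_mul_conjTranspose_nonneg {m n : Type*} [Fintype m] [DecidableEq m] [Fintype n]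
    (B : Matrix m n ℂ) : 0 ≤ (B * Bᴴ).det.re ∧ (B * Bᴴ).det.im = 0 := by
  have h := Complex.le_def.1 (posSemidef_self_mul_conjTranspose B).det_nonneg
  exact ⟨h.1, h.2.symm⟩

/-- If `U` has orthonormal rows and `Û = U_{:,S}` is an `r × n` column submatrix of nonzero
volume with locally maximal volume under single-column exchanges, then `Û Ûᴴ` is invertible
and `trace((Û Ûᴴ)⁻¹) ≤ r + r(N−n)/(n−r+1)`, i.e. `‖Û⁺‖_F ≤ √(r + r(N−n)/(n−r+1))`. -/
theorem statement12 (r n N : ℕ) (hrn : r ≤ n) (hnN : n ≤ N)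
    (U : Matrix (Fin r) (Fin N) ℂ) (hU : U * Uᴴ = 1)
    (S : Finset (Fin N)) (hS : S.card = n)
    (hvol : sqVol U S ≠ 0)
    (hloc : ∀ j ∈ S, ∀ i ∉ S, sqVol U (insert i (S.erase j)) ≤ sqVol U S) :
    IsUnit (colsSub U S * (colsSub U S)ᴴ).det ∧
      ((colsSub U S * (colsSub U S)ᴴ)⁻¹).trace.re
        ≤ (r : ℝ) + (r : ℝ) * ((N : ℝ) - (n : ℝ)) / ((n : ℝ) - (r : ℝ) + 1) := by
  have hA : IsUnit (colsSub U S * (colsSub U S)ᴴ).det := by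
    rw [isUnit_iff_ne_zero]
    intro h
    exact hvol (by simp [sqVol, h])
  refine ⟨hA, ?_⟩
  have hdet := det_mul_conjTranspose_nonneg (colsSub U S)
  have hex := fun (i j : Fin N) (hj : j ∈ S) (hi : i ∉ S) =>
    det_colsSub_exchange U S hA hj hi rfl
  have hG : ((colsSub U S * (colsSub U S)ᴴ)⁻¹).IsHermitian :=
    (isHermitian_mul_conjTranspose_self (colsSub U S)).inv
  have hAD := colsSub_mul_conjTranspose_s12 U S
  unfold sqVol at hvol hloc
  set A := colsSub U S * (colsSub U S)ᴴ with hAdef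
  set P := Uᴴ * A⁻¹ * U with hP
  set D : Matrix (Fin N) (Fin N) ℂ := diagonal (fun k => if k ∈ S then (1 : ℂ) else 0) with hD
  have hPH (a b : Fin N) : P b a = star (P a b) := by
    have : P.IsHermitian := isHermitian_conjTranspose_mul_mul U hG
    exact (this.apply b a).symm
  have htr : P.trace = A⁻¹.trace := by
    rw [hP, Matrix.trace_mul_comm, ← Matrix.mul_assoc, hU, Matrix.one_mul]
  have htrS : ∑ j ∈ S, P j j = r := by
    have h1 : (P * D).trace = r := by
      rw [hP, Matrix.mul_assoc, Matrix.trace_mul_comm, ← Matrix.mul_assoc, ← hAD,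
        mul_nonsing_inv A hA]
      simp
    rw [← h1]
    simp [trace, hD, mul_diagonal]
  have hproj (i : Fin N) : ∑ j ∈ S, P i j * P j i = P i i := by
    have h1 : P * D * P = P := by
      have : P * D * P = Uᴴ * (A⁻¹ * (U * D * Uᴴ) * A⁻¹) * U := by
        simp only [hP, Matrix.mul_assoc]
      rw [this, ← hAD, nonsing_inv_mul A hA, Matrix.one_mul]
    conv_rhs => rw [← h1]
    simp [mul_apply, hD, diagonal_apply]
  have hdpos : 0 < A.det.re := lt_of_le_of_ne hdet.1 (Ne.symm hvol)
  have hdim : A.det.im = 0 := hdet.2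
  have hPim (a : Fin N) : (P a a).im = 0 := by
    have := congrArg Complex.im (hPH a a)
    simp at this
    linarith
  have hineq (i : Fin N) (hi : i ∉ S) (j : Fin N) (hj : j ∈ S) :
      (1 + (P i i).re) * (1 - (P j j).re) + (P i j * P j i).re ≤ 1 := by
    have h := hloc j hj i hi
    rw [hex i j hj hi, Complex.mul_re, hdim] at h
    simp only [Complex.add_re, Complex.mul_re (1 + _), Complex.sub_re, Complex.add_im,
      Complex.sub_im, hPim, Complex.one_re, Complex.one_im] at h
    nlinarith
  have hden : (0 : ℝ) < (n : ℝ) - r + 1 := by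
    have : (r : ℝ) ≤ n := by exact_mod_cast hrn
    linarith
  have hbound (i : Fin N) (hi : i ∉ S) : (P i i).re ≤ r / ((n : ℝ) - r + 1) := by
    have h := Finset.sum_le_sum (hineq i hi)
    have h1 := congrArg Complex.re htrS
    have h2 := congrArg Complex.re (hproj i)
    rw [Complex.re_sum] at h1 h2
    rw [Finset.sum_add_distrib, ← Finset.mul_sum, Finset.sum_sub_distrib, h1, h2] at h
    simp [hS] at h
    rw [le_div_iff₀ hden]
    linarith
  have hsplit : A⁻¹.trace.re = r + ∑ i ∈ Sᶜ, (P i i).re := by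
    rw [← htr, trace, Complex.re_sum, ← Finset.sum_add_sum_compl S]
    have h1 := congrArg Complex.re htrS
    rw [Complex.re_sum] at h1
    simp only [diag_apply, h1, Complex.natCast_re]
  have hsum := Finset.sum_le_card_nsmul Sᶜ (fun i => (P i i).re) _
    (fun i hi => hbound i (Finset.mem_compl.1 hi))
  rw [Finset.card_compl, Fintype.card_fin, hS, nsmul_eq_mul, Nat.cast_sub hnN] at hsum
  rw [hsplit, mul_div_right_comm, mul_comm ((r : ℝ) / _)]
  linarith
end
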